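/- Let k ≥ 1, let φ be a k-coherent propositional dependence logic formula, and let ψ be a propositional dependence logic formula. Then φ ⊨ ψ if and only if both: (i) φ ∧ ψ is k-coherent, and (ii) φ ⊨_k ψ. -/

import Mathlib

/-! Propositional dependence logic with team semantics. -/

/-- Formulas of propositional dependence logic over propositional variables `P`. -/
inductive PDL (P : Type) : Type where
  | var (p : P) : PDL P
  | nvar (p : P) : PDL P
  | dep (m : ℕ) (ps : Fin m → P) (q : P) : PDL P
  | and (φ ψ : PDL P) : PDL P
  | or (φ ψ : PDL P) : PDL P

/-- Team semantics for propositional dependence logic: a propositional team is a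
set of assignments `P → Bool`. -/
def PSat {P : Type} : Set (P → Bool) → PDL P → Prop
  | T, .var p => ∀ s ∈ T, s p = true
  | T, .nvar p => ∀ s ∈ T, s p = false
  | T, .dep _ ps q => ∀ s₁ ∈ T, ∀ s₂ ∈ T, (∀ i, s₁ (ps i) = s₂ (ps i)) → s₁ q = s₂ q
  | T, .and φ ψ => PSat T φ ∧ PSat T ψ
  | T, .or φ ψ => ∃ T₁ T₂, T = T₁ ∪ T₂ ∧ PSat T₁ φ ∧ PSat T₂ ψ

/-- `φ` is `k`-coherent: a propositional team satisfies `φ` iff all its subteams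
with at most `k` elements do. -/
def PKCoherent {P : Type} (k : ℕ) (φ : PDL P) : Prop :=
  ∀ T : Set (P → Bool), PSat T φ ↔ ∀ S ⊆ T, S.Finite → S.ncard ≤ k → PSat S φ

/-- Let `k ≥ 1`, `φ` a `k`-coherent PDL formula and `ψ` a PDL
formula. Then `φ ⊨ ψ` iff `φ ∧ ψ` is `k`-coherent and `φ ⊨_k ψ` (every team of size
at most `k` satisfying `φ` satisfies `ψ`). -/
theorem stmt18 {P : Type} (k : ℕ) (hk : 1 ≤ k) (φ ψ : PDL P)
    (hφ : PKCoherent k φ) :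
    (∀ T : Set (P → Bool), PSat T φ → PSat T ψ) ↔
      (PKCoherent k (.and φ ψ) ∧
        ∀ T : Set (P → Bool), T.Finite → T.ncard ≤ k → PSat T φ → PSat T ψ) := by
  constructor
  · intro h
    refine ⟨fun T => ⟨fun hT S hS hf hc => ?_, fun hT => ?_⟩, fun T _ _ hT => h T hT⟩
    · have h1 : PSat S φ := (hφ T).1 hT.1 S hS hf hc
      exact ⟨h1, h S h1⟩
    · have h1 : PSat T φ := (hφ T).2 fun S hS hf hc => (hT S hS hf hc).1
      exact ⟨h1, h T h1⟩
  · rintro ⟨hc, hk'⟩ T hT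
    have h1 : PSat T (.and φ ψ) := (hc T).2 fun S hS hf hn =>
      have h2 : PSat S φ := (hφ T).1 hT S hS hf hn
      ⟨h2, hk' S hf hn h2⟩
    exact h1.2
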